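/- Let M ⊂ ℂⁿ (n ≥ 3) be a smooth pseudoconvex real hypersurface with defining function ρ, let p ∈ M, and let L₁,…,L_s be smooth CR vector fields along M whose values at every point are ℂ-linearly independent, spanning a rank-s subbundle B of T^{1,0}M. Then the minimum, over smooth sections L = Σ_j a_j L_j of B with L(p) ≠ 0, of ν_B(λ(L,L))(p) is either an even number or infinite; consequently the Levi-form type c^{(s)}(B,p) = 2 + min_L ν_B(λ(L,L))(p) is even if finite. -/

import Mathlib

open Topology

/-- ℂⁿ as a Pi type. -/
abbrev Cn (n : ℕ) := Fin n → ℂ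

/-- The Wirtinger derivative `∂f/∂z_j` of a (real-)smooth function `f : ℂⁿ → ℂ`. -/
noncomputable def wz {n : ℕ} (j : Fin n) (f : Cn n → ℂ) (x : Cn n) : ℂ :=
  (fderiv ℝ f x (Pi.single j 1) - Complex.I * fderiv ℝ f x (Pi.single j Complex.I)) / 2

/-- The Wirtinger derivative `∂f/∂z̄_j` of a (real-)smooth function `f : ℂⁿ → ℂ`. -/
noncomputable def wzb {n : ℕ} (j : Fin n) (f : Cn n → ℂ) (x : Cn n) : ℂ :=
  (fderiv ℝ f x (Pi.single j 1) + Complex.I * fderiv ℝ f x (Pi.single j Complex.I)) / 2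

/-- The complexification of a real-valued function on ℂⁿ. -/
def cx {n : ℕ} (ρ : Cn n → ℝ) : Cn n → ℂ := fun x => (ρ x : ℂ)

/-- A complex vector field of mixed type `(1,0) + (0,1)` on ℂⁿ:
`W = Σ_j hol_j ∂/∂z_j + Σ_j anti_j ∂/∂z̄_j`. -/
structure CVF (n : ℕ) where
  hol : Fin n → Cn n → ℂ
  anti : Fin n → Cn n → ℂ

/-- Action of a mixed-type complex vector field on functions, as a derivation. -/
noncomputable def CVF.act {n : ℕ} (W : CVF n) (f : Cn n → ℂ) : Cn n → ℂ :=
  fun x => (∑ j, W.hol j x * wz j f x) + (∑ j, W.anti j x * wzb j f x)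

/-- Lie bracket of two mixed-type complex vector fields (with smooth coefficients the
commutator `[V,W]` of the first–order operators is again first order with these
coefficients). -/
noncomputable def CVF.bracket {n : ℕ} (V W : CVF n) : CVF n where
  hol := fun j x => V.act (W.hol j) x - W.act (V.hol j) x
  anti := fun j x => V.act (W.anti j) x - W.act (V.anti j) x

/-- The `(1,0)` vector field `L = Σ_j a_j ∂/∂z_j`. -/
def LVF {n : ℕ} (a : Fin n → Cn n → ℂ) : CVF n := ⟨a, fun _ _ => 0⟩

/-- The conjugate `(0,1)` vector field `L̄ = Σ_j ā_j ∂/∂z̄_j`. -/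
def LbarVF {n : ℕ} (a : Fin n → Cn n → ℂ) : CVF n :=
  ⟨fun _ _ => 0, fun j x => starRingEnd ℂ (a j x)⟩

/-- `a` is a smooth CR vector field along `M = {ρ = 0}`: smooth coefficients annihilating
`ρ` in the `(1,0)` directions, i.e. `Σ_j a_j ∂ρ/∂z_j = 0` on `M`. -/
def IsCRField {n : ℕ} (ρ : Cn n → ℝ) (M : Set (Cn n)) (a : Fin n → Cn n → ℂ) : Prop :=
  (∀ j, ContDiff ℝ (⊤ : ℕ∞) (a j)) ∧ ∀ x ∈ M, ∑ j, a j x * wz j (cx ρ) x = 0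

/-- Membership in the module `𝓜₁(L)` generated over smooth functions by `L` and `L̄`. -/
def InM1 {n : ℕ} (a : Fin n → Cn n → ℂ) (W : CVF n) : Prop :=
  ∃ c₁ c₂ : Cn n → ℂ, ContDiff ℝ (⊤ : ℕ∞) c₁ ∧ ContDiff ℝ (⊤ : ℕ∞) c₂ ∧
    (∀ j x, W.hol j x = c₁ x * a j x) ∧ (∀ j x, W.anti j x = c₂ x * starRingEnd ℂ (a j x))

/-- `ν_L(f)(p)`: the smallest `m` such that `Y_m(⋯(Y_1 f)⋯)(p) ≠ 0` for some
`Y₁, …, Y_m ∈ 𝓜₁(L)`; `⊤` if no such `m` exists. -/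
noncomputable def nuL {n : ℕ} (a : Fin n → Cn n → ℂ) (f : Cn n → ℂ) (p : Cn n) : ℕ∞ :=
  sInf {m : ℕ∞ | ∃ Ws : List (CVF n), (Ws.length : ℕ∞) = m ∧ (∀ W ∈ Ws, InM1 a W) ∧
    (Ws.foldl (fun g W => W.act g) f) p ≠ 0}

/-- The coefficient `∂²ρ/∂z_j ∂z̄_l` of the Levi form. -/
noncomputable def leviCoeff {n : ℕ} (ρ : Cn n → ℝ) (j l : Fin n) (x : Cn n) : ℂ :=
  wz j (wzb l (cx ρ)) x

/-- The Levi form `λ(X,Y) = Σ_{j,l} (∂²ρ/∂z_j∂z̄_l) ξ_j η̄_l` of the fields with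
coefficients `ξ`, `η`, as a function on ℂⁿ. -/
noncomputable def levi {n : ℕ} (ρ : Cn n → ℝ) (ξ η : Fin n → Cn n → ℂ) (x : Cn n) : ℂ :=
  ∑ j, ∑ l, leviCoeff ρ j l x * ξ j x * starRingEnd ℂ (η l x)

/-- `M = {ρ = 0}` is pseudoconvex: the Levi form is positive semi-definite on the
CR directions at every point of `M`. -/
def Pseudoconvex {n : ℕ} (ρ : Cn n → ℝ) (M : Set (Cn n)) : Prop :=
  ∀ x ∈ M, ∀ ξ : Fin n → ℂ, (∑ j, ξ j * wz j (cx ρ) x) = 0 →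
    0 ≤ (∑ j, ∑ l, leviCoeff ρ j l x * ξ j * starRingEnd ℂ (ξ l)).re

/-- Iterated commutators of length `μ` of elements of `𝓜₁(L)`:
`[Y_μ, [Y_{μ-1}, ⋯ [Y₂, Y₁]⋯]]` with each `Y_i ∈ 𝓜₁(L)`. -/
inductive IsCommOf {n : ℕ} (a : Fin n → Cn n → ℂ) : ℕ → CVF n → Prop
  | one (W : CVF n) : InM1 a W → IsCommOf a 1 W
  | succ {μ : ℕ} (V W : CVF n) : InM1 a V → IsCommOf a μ W → IsCommOf a (μ + 1) (V.bracket W)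

/-- The pairing `⟨∂ρ, G⟩(p)` of a mixed-type field with the `(1,0)` form `∂ρ`. -/
noncomputable def pairDRho {n : ℕ} (ρ : Cn n → ℝ) (G : CVF n) (p : Cn n) : ℂ :=
  ∑ j, G.hol j p * wz j (cx ρ) p

/-- The commutator type `t_L(M,p)`: the smallest `m` such that `⟨∂ρ, G⟩(p) ≠ 0` for some
iterated commutator `G` of length (at most) `m` of elements of `𝓜₁(L)`; `⊤` if none. -/
noncomputable def tType {n : ℕ} (ρ : Cn n → ℝ) (a : Fin n → Cn n → ℂ) (p : Cn n) : ℕ∞ :=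
  sInf {m : ℕ∞ | ∃ μ : ℕ, (μ : ℕ∞) = m ∧ ∃ G : CVF n, IsCommOf a μ G ∧ pairDRho ρ G p ≠ 0}

/-- The Levi-form type `c_L(M,p) = 2 + ν_L(λ(L,L))(p)`. -/
noncomputable def cType {n : ℕ} (ρ : Cn n → ℝ) (a : Fin n → Cn n → ℂ) (p : Cn n) : ℕ∞ :=
  2 + nuL a (levi ρ a a) p

/-- Membership in the module `𝓜₁(B)` generated over smooth functions by the frame
`L₁, …, L_s` of `B` (with coefficient functions `A i`) and their conjugates. -/
def InM1B {n s : ℕ} (A : Fin s → Fin n → Cn n → ℂ) (W : CVF n) : Prop :=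
  ∃ c d : Fin s → Cn n → ℂ,
    (∀ i, ContDiff ℝ (⊤ : ℕ∞) (c i)) ∧ (∀ i, ContDiff ℝ (⊤ : ℕ∞) (d i)) ∧
    (∀ j x, W.hol j x = ∑ i, c i x * A i j x) ∧
    (∀ j x, W.anti j x = ∑ i, d i x * starRingEnd ℂ (A i j x))

/-- `ν_B(f)(p)`: the smallest `m` such that `Y_m(⋯(Y_1 f)⋯)(p) ≠ 0` for some
`Y₁, …, Y_m ∈ 𝓜₁(B)`; `⊤` if no such `m` exists. -/
noncomputable def nuB {n s : ℕ} (A : Fin s → Fin n → Cn n → ℂ) (f : Cn n → ℂ)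
    (p : Cn n) : ℕ∞ :=
  sInf {m : ℕ∞ | ∃ Ws : List (CVF n), (Ws.length : ℕ∞) = m ∧ (∀ W ∈ Ws, InM1B A W) ∧
    (Ws.foldl (fun g W => W.act g) f) p ≠ 0}

/-- The coefficients of the section `L = Σ_i b_i L_i` of `B`. -/
noncomputable def secCoeff {n s : ℕ} (A : Fin s → Fin n → Cn n → ℂ)
    (b : Fin s → Cn n → ℂ) : Fin n → Cn n → ℂ :=
  fun j x => ∑ i, b i x * A i j x

/-- `min_L ν_B(λ(L,L))(p)` over smooth sections `L` of `B` with `L(p) ≠ 0`. -/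
noncomputable def minNuLevi {n s : ℕ} (ρ : Cn n → ℝ) (A : Fin s → Fin n → Cn n → ℂ)
    (p : Cn n) : ℕ∞ :=
  sInf {m : ℕ∞ | ∃ b : Fin s → Cn n → ℂ, (∀ i, ContDiff ℝ (⊤ : ℕ∞) (b i)) ∧
    (fun j => secCoeff A b j p) ≠ 0 ∧
    m = nuB A (levi ρ (secCoeff A b) (secCoeff A b)) p}

/-- The Levi-form type `c^{(s)}(B,p) = 2 + min_L ν_B(λ(L,L))(p)`. -/
noncomputable def cTypeB {n s : ℕ} (ρ : Cn n → ℝ) (A : Fin s → Fin n → Cn n → ℂ)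
    (p : Cn n) : ℕ∞ :=
  2 + minNuLevi ρ A p

/-- Iterated commutators of length `μ` of elements of `𝓜₁(B)`. -/
inductive IsCommOfB {n s : ℕ} (A : Fin s → Fin n → Cn n → ℂ) : ℕ → CVF n → Prop
  | one (W : CVF n) : InM1B A W → IsCommOfB A 1 W
  | succ {μ : ℕ} (V W : CVF n) : InM1B A V → IsCommOfB A μ W →
      IsCommOfB A (μ + 1) (V.bracket W)

/-- The commutator type `t^{(s)}(B,p)`: the smallest `m` such that `⟨∂ρ, G⟩(p) ≠ 0` for
some iterated commutator `G` of length (at most) `m` of elements of `𝓜₁(B)`; `⊤` if none. -/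
noncomputable def tTypeB {n s : ℕ} (ρ : Cn n → ℝ) (A : Fin s → Fin n → Cn n → ℂ)
    (p : Cn n) : ℕ∞ :=
  sInf {m : ℕ∞ | ∃ μ : ℕ, (μ : ℕ∞) = m ∧ ∃ G : CVF n, IsCommOfB A μ G ∧ pairDRho ρ G p ≠ 0}

/-- `A` is a smooth frame of a rank-`s` CR subbundle `B ⊆ T^{1,0}M`: each `L_i` is a smooth
CR vector field along `M` and the values `L₁(x), …, L_s(x)` are ℂ-linearly independent at
every point `x ∈ M`. -/
def IsCRFrame {n s : ℕ} (ρ : Cn n → ℝ) (M : Set (Cn n))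
    (A : Fin s → Fin n → Cn n → ℂ) : Prop :=
  (∀ i, IsCRField ρ M (A i)) ∧ ∀ x ∈ M, LinearIndependent ℂ (fun i => fun j => A i j x)


section FlowExpansion

open Filter Asymptotics

variable {E F : Type*} [NormedAddCommGroup E] [NormedSpace ℝ E]
  [NormedAddCommGroup F] [NormedSpace ℝ F]

/-- The derivative of `g` along the vector field `X`. -/
noncomputable def dirDeriv (X : E → E) (g : E → F) : E → F := fun x => fderiv ℝ g x (X x)

/-- The iterated derivative `X_m (⋯ (X_1 g))` along a list `[X_1, …, X_m]` of vector fields. -/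
noncomputable def iterDirDeriv (Xs : List (E → E)) (g : E → F) : E → F :=
  Xs.foldl (fun h X => dirDeriv X h) g

theorem ContDiff.dirDeriv {X : E → E} {g : E → F} (hg : ContDiff ℝ (⊤ : ℕ∞) g)
    (hX : ContDiff ℝ (⊤ : ℕ∞) X) : ContDiff ℝ (⊤ : ℕ∞) (dirDeriv X g) :=
  (hg.fderiv_right (m := (⊤ : ℕ∞)) (by simp)).clm_apply hX

theorem ContDiff.iterate_dirDeriv {X : E → E} {g : E → F} (hg : ContDiff ℝ (⊤ : ℕ∞) g)
    (hX : ContDiff ℝ (⊤ : ℕ∞) X) (k : ℕ) : ContDiff ℝ (⊤ : ℕ∞) ((_root_.dirDeriv X)^[k] g) := by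
  induction k generalizing g with
  | zero => exact hg
  | succ k ih => exact ih (hg.dirDeriv hX)

/-- Taylor's formula along an integral curve of a vector field. -/
theorem abs_comp_integralCurve_sub_taylor_le {X : E → E} (hX : ContDiff ℝ (⊤ : ℕ∞) X)
    {γ : ℝ → E} {δ C : ℝ} (hγ : ∀ t, |t| < δ → HasDerivAt γ (X (γ t)) t) (N : ℕ) {g : E → ℝ}
    (hg : ContDiff ℝ (⊤ : ℕ∞) g) (hC : ∀ t, |t| < δ → |(dirDeriv X)^[N] g (γ t)| ≤ C)
    {t : ℝ} (ht : |t| < δ) :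
    |g (γ t) - ∑ k ∈ Finset.range N, t ^ k * ((k.factorial : ℝ)⁻¹ * (dirDeriv X)^[k] g (γ 0))|
      ≤ C * |t| ^ N := by
  induction N generalizing g t with
  | zero => simpa using hC t ht
  | succ N ih =>
    have hC0 : 0 ≤ C := (abs_nonneg _).trans (hC t ht)
    set h : ℝ → ℝ := fun t => g (γ t) - ∑ k ∈ Finset.range (N + 1),
      t ^ k * ((k.factorial : ℝ)⁻¹ * (dirDeriv X)^[k] g (γ 0)) with hh
    have hder : ∀ s, |s| < δ → HasDerivAt h (dirDeriv X g (γ s) - ∑ k ∈ Finset.range N,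
        s ^ k * ((k.factorial : ℝ)⁻¹ * (dirDeriv X)^[k] (dirDeriv X g) (γ 0))) s := by
      intro s hs
      refine HasDerivAt.sub ?_ ?_
      · exact (hg.differentiable (by simp)).differentiableAt.hasFDerivAt.comp_hasDerivAt s
          (hγ s hs)
      · have : HasDerivAt (fun t : ℝ => ∑ k ∈ Finset.range (N + 1),
            t ^ k * ((k.factorial : ℝ)⁻¹ * (dirDeriv X)^[k] g (γ 0)))
            (∑ k ∈ Finset.range (N + 1), (k * s ^ (k - 1)) *
              ((k.factorial : ℝ)⁻¹ * (dirDeriv X)^[k] g (γ 0))) s :=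
          HasDerivAt.fun_sum fun k _ => (hasDerivAt_pow k s).mul_const _
        refine this.congr_deriv ?_
        rw [Finset.sum_range_succ']
        simp only [Nat.cast_zero, zero_mul, add_zero]
        refine Finset.sum_congr rfl fun k _ => ?_
        rw [Function.iterate_succ_apply, Nat.factorial_succ]
        have := Nat.factorial_ne_zero k
        push_cast
        field_simp
    have hmem : ∀ s ∈ Metric.closedBall (0 : ℝ) |t|, |s| ≤ |t| := fun s hs => by
      simpa using hs
    have := (convex_closedBall (0 : ℝ) |t|).norm_image_sub_le_of_norm_hasDerivWithin_le
      (C := C * |t| ^ N)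
      (fun s hs => (hder s ((hmem s hs).trans_lt ht)).hasDerivWithinAt)
      (fun s hs => (ih (hg.dirDeriv hX) hC ((hmem s hs).trans_lt ht)).trans
        (mul_le_mul_of_nonneg_left (pow_le_pow_left₀ (abs_nonneg s) (hmem s hs) N) hC0))
      (x := 0) (y := t) (by simp) (by simp)
    have h0 : h 0 = 0 := by
      simp [hh, Finset.sum_range_succ']
    rw [h0, sub_zero, sub_zero] at this
    simpa [pow_succ, mul_assoc] using this

/-- A vector field tangent to a regular level set `{ρ = 0}` has a local flow preserving it. -/
theorem exists_flow_in_zeroSet [CompleteSpace E] {ρ : E → ℝ} (hρ : ContDiff ℝ (⊤ : ℕ∞) ρ) {p : E}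
    (hreg : fderiv ℝ ρ p ≠ 0) {X : E → E} (hX : ContDiff ℝ (⊤ : ℕ∞) X)
    (htan : ∀ x, ρ x = 0 → fderiv ℝ ρ x (X x) = 0) :
    ∃ γ : E → ℝ → E, Tendsto (Function.uncurry γ) (𝓝 (p, 0)) (𝓝 p) ∧ ∃ δ > 0,
      ∀ x ∈ Metric.ball p δ, ρ x = 0 → γ x 0 = x ∧
        ∀ t, |t| < δ → ρ (γ x t) = 0 ∧ HasDerivAt (γ x) (X (γ x t)) t := by
  obtain ⟨v, hv⟩ : ∃ v, fderiv ℝ ρ p v ≠ 0 := by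
    by_contra! h
    exact hreg (ContinuousLinearMap.ext h)
  have hdρ : ContDiff ℝ (⊤ : ℕ∞) (fderiv ℝ ρ) := hρ.fderiv_right (by simp)
  set Y : E → E := fun x => X x - (fderiv ℝ ρ x (X x) / fderiv ℝ ρ x v) • v with hY
  have hYs : ContDiffAt ℝ 1 Y p := by
    have h1 : ContDiffAt ℝ (⊤ : ℕ∞) Y p := hX.contDiffAt.sub
      (((hdρ.clm_apply hX).contDiffAt.div (hdρ.clm_apply contDiff_const).contDiffAt hv).smul
        contDiffAt_const)
    exact h1.of_le (by simp)
  obtain ⟨ε, hε, a, r, L, K, hr, hpl⟩ := IsPicardLindelof.of_contDiffAt_one hYs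
  obtain ⟨α, hα, hαc⟩ :=
    (hpl 0).exists_forall_mem_closedBall_eq_hasDerivWithinAt_continuousOn
  have hr' : (0 : ℝ) < r := hr
  have hnhds : Metric.closedBall p (r : ℝ) ×ˢ Set.Icc (0 - ε) (0 + ε) ∈ 𝓝 (p, (0 : ℝ)) :=
    prod_mem_nhds (Metric.closedBall_mem_nhds p hr') (Icc_mem_nhds (by linarith) (by linarith))
  have hα0 : α (p, 0) = p := (hα p (Metric.mem_closedBall_self hr'.le)).1
  have hcont : Tendsto α (𝓝 (p, 0)) (𝓝 p) := by
    have := hαc.continuousAt hnhds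
    rwa [ContinuousAt, hα0] at this
  refine ⟨fun x t => α (x, t), hcont, ?_⟩
  have hU : ∀ᶠ x in 𝓝 p, fderiv ℝ ρ x v ≠ 0 :=
    (hdρ.clm_apply contDiff_const).continuous.continuousAt.eventually_ne hv
  obtain ⟨δ, hδ, hball⟩ := Metric.mem_nhds_iff.1 (inter_mem hnhds (hcont hU))
  have hmem : ∀ x ∈ Metric.ball p δ, ∀ t : ℝ, |t| < δ → (x, t) ∈ Metric.ball (p, (0 : ℝ)) δ := by
    intro x hx t ht
    rw [← ball_prod_same]
    exact ⟨hx, by simpa using ht⟩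
  refine ⟨min δ ε, lt_min hδ hε, fun x hx hρx => ?_⟩
  have hxδ : x ∈ Metric.ball p δ := Metric.ball_subset_ball (min_le_left _ _) hx
  have hxr : x ∈ Metric.closedBall p (r : ℝ) := by
    simpa using (hball (hmem x hxδ 0 (by simpa using hδ))).1.1
  obtain ⟨hx0, hxd⟩ := hα x hxr
  have hx0' : α (x, 0) = x := hx0
  refine ⟨hx0', ?_⟩
  have hd : ∀ t, |t| < min δ ε → HasDerivAt (fun t => α (x, t)) (Y (α (x, t))) t := by
    intro t ht
    have ht' := abs_lt.1 (ht.trans_le (min_le_right _ _))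
    exact (hxd t ⟨by linarith, by linarith⟩).hasDerivAt
      (Icc_mem_nhds (by linarith) (by linarith))
  have hzero : ∀ t, |t| < min δ ε → ρ (α (x, t)) = 0 := by
    intro t ht
    have hm : ∀ s ∈ Metric.closedBall (0 : ℝ) |t|, |s| < min δ ε := fun s hs =>
      lt_of_le_of_lt (by simpa using hs) ht
    have := (convex_closedBall (0 : ℝ) |t|).norm_image_sub_le_of_norm_hasDerivWithin_le (C := 0)
      (f := fun s => ρ (α (x, s))) (f' := fun s => fderiv ℝ ρ (α (x, s)) (Y (α (x, s))))
      (fun s hs => (((hρ.differentiable (by simp)).differentiableAt.hasFDerivAt).comp_hasDerivAt s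
        (hd s (hm s hs))).hasDerivWithinAt)
      (fun s hs => by
        have hne : fderiv ℝ ρ (α (x, s)) v ≠ 0 :=
          (hball (hmem x hxδ s ((hm s hs).trans_le (min_le_left _ _)))).2
        simp [hY, hne]) (x := 0) (y := t) (by simp) (by simp)
    simpa [hx0', hρx] using this
  refine fun t ht => ⟨hzero t ht, ?_⟩
  have := hd t ht
  simpa [hY, htan _ (hzero t ht)] using this

/-- The coefficient of `τ ^ j` in the expansion at `p` of `g` along the composition of the
time-`τ` flows of a list of vector fields, the field at the head of the list flowing last. -/
noncomputable def flowCoeff (p : E) : List (E → E) → ℕ → (E → ℝ) → ℝ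
  | [], 0, g => g p
  | [], _ + 1, _ => 0
  | X :: Xs, j, g => ∑ k ∈ Finset.range (j + 1),
      (k.factorial : ℝ)⁻¹ * flowCoeff p Xs (j - k) ((dirDeriv X)^[k] g)

/-- Following the flows of tangent fields produces points of `{ρ = 0}` along which every smooth
function has the expansion with coefficients `flowCoeff`. -/
theorem exists_flow_expansion [CompleteSpace E] {ρ : E → ℝ} (hρ : ContDiff ℝ (⊤ : ℕ∞) ρ) {p : E}
    (hp : ρ p = 0) (hreg : fderiv ℝ ρ p ≠ 0) (Xs : List (E → E))
    (hXs : ∀ X ∈ Xs, ContDiff ℝ (⊤ : ℕ∞) X ∧ ∀ x, ρ x = 0 → fderiv ℝ ρ x (X x) = 0) :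
    ∃ y : ℝ → E, Tendsto y (𝓝 0) (𝓝 p) ∧ (∀ᶠ τ in 𝓝 0, ρ (y τ) = 0) ∧
      ∀ g : E → ℝ, ContDiff ℝ (⊤ : ℕ∞) g → ∀ N : ℕ,
        (fun τ => g (y τ) - ∑ j ∈ Finset.range N, τ ^ j * flowCoeff p Xs j g)
          =O[𝓝 0] fun τ => τ ^ N := by
  induction Xs with
  | nil =>
    refine ⟨fun _ => p, tendsto_const_nhds, Eventually.of_forall fun _ => hp, fun g _ N => ?_⟩
    cases N with
    | zero => simpa using isBigO_const_const (g p) (one_ne_zero (α := ℝ)) (𝓝 (0 : ℝ))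
    | succ N => simpa [Finset.sum_range_succ', flowCoeff] using isBigO_zero _ _
  | cons X Xs ih =>
    obtain ⟨y, hyp, hyM, hy⟩ := ih fun Z hZ => hXs Z (List.mem_cons_of_mem _ hZ)
    obtain ⟨hX, htan⟩ := hXs X List.mem_cons_self
    obtain ⟨γ, hγ, δ, hδ, hflow⟩ := exists_flow_in_zeroSet hρ hreg hX htan
    have hgood : ∀ᶠ τ in 𝓝 (0 : ℝ), y τ ∈ Metric.ball p δ ∧ ρ (y τ) = 0 ∧ |τ| < δ := by
      filter_upwards [hyp (Metric.ball_mem_nhds p hδ), hyM, Metric.ball_mem_nhds (0 : ℝ) hδ]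
        with τ h1 h2 h3
      exact ⟨h1, h2, by simpa using h3⟩
    refine ⟨fun τ => γ (y τ) τ, hγ.comp (hyp.prodMk_nhds tendsto_id), ?_, fun g hg N => ?_⟩
    · filter_upwards [hgood] with τ ⟨h1, h2, h3⟩
      exact ((hflow _ h1 h2).2 τ h3).1
    have htaylor : (fun τ => g (γ (y τ) τ) - ∑ k ∈ Finset.range N,
        τ ^ k * ((k.factorial : ℝ)⁻¹ * (dirDeriv X)^[k] g (y τ))) =O[𝓝 0] fun τ => τ ^ N := by
      have hbd : ∀ᶠ z in 𝓝 p,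
          |(dirDeriv X)^[N] g z| < |(dirDeriv X)^[N] g p| + 1 :=
        (hg.iterate_dirDeriv hX N).continuous.abs.continuousAt.eventually_lt_const
          (lt_add_one _)
      obtain ⟨η, hη, hball⟩ := Metric.mem_nhds_iff.1 (hγ hbd)
      refine IsBigO.of_bound (|(dirDeriv X)^[N] g p| + 1) ?_
      filter_upwards [hgood, hyp (Metric.ball_mem_nhds p hη), Metric.ball_mem_nhds (0 : ℝ) hη]
        with τ ⟨h1, h2, h3⟩ h4 h5
      obtain ⟨h0, hcurve⟩ := hflow _ h1 h2
      have := abs_comp_integralCurve_sub_taylor_le hX (γ := γ (y τ)) (δ := min δ η)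
        (C := |(dirDeriv X)^[N] g p| + 1) (fun t ht => (hcurve t (ht.trans_le (min_le_left _ _))).2)
        N hg (fun t ht => by
          have hm : (y τ, t) ∈ Metric.ball (p, (0 : ℝ)) η := by
            rw [← ball_prod_same]
            exact ⟨h4, by simpa using ht.trans_le (min_le_right _ _)⟩
          exact le_of_lt (hball hm)) (t := τ) (lt_min h3 (by simpa using h5))
      rw [h0] at this
      simpa using this
    have hterm : ∀ k ∈ Finset.range N, (fun τ => τ ^ k * ((k.factorial : ℝ)⁻¹ *
        ((dirDeriv X)^[k] g (y τ) - ∑ j ∈ Finset.range (N - k),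
          τ ^ j * flowCoeff p Xs j ((dirDeriv X)^[k] g)))) =O[𝓝 0] fun τ : ℝ => τ ^ N := by
      intro k hk
      have h := (isBigO_refl (fun τ : ℝ => τ ^ k) (𝓝 0)).mul
        ((hy _ (hg.iterate_dirDeriv hX k) (N - k)).const_mul_left (k.factorial : ℝ)⁻¹)
      refine h.congr_right fun τ => ?_
      rw [← pow_add, Nat.add_sub_cancel' (Finset.mem_range.1 hk).le]
    refine (htaylor.add (IsBigO.sum hterm)).congr_left fun τ => ?_
    have hflip := Finset.sum_range_diag_flip N fun k j =>
      τ ^ (k + j) * ((k.factorial : ℝ)⁻¹ * flowCoeff p Xs j ((dirDeriv X)^[k] g))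
    have hsum : ∑ j ∈ Finset.range N, τ ^ j * flowCoeff p (X :: Xs) j g =
        ∑ k ∈ Finset.range N, ∑ j ∈ Finset.range (N - k),
          τ ^ (k + j) * ((k.factorial : ℝ)⁻¹ * flowCoeff p Xs j ((dirDeriv X)^[k] g)) := by
      rw [← hflip]
      refine Finset.sum_congr rfl fun j _ => ?_
      rw [flowCoeff, Finset.mul_sum]
      refine Finset.sum_congr rfl fun k hk => ?_
      rw [Nat.add_sub_cancel' (Finset.mem_range_succ_iff.1 hk)]
    rw [hsum, sub_add, Finset.sum_apply, ← Finset.sum_sub_distrib]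
    congr 1
    refine Finset.sum_congr rfl fun k _ => ?_
    rw [mul_sub, mul_sub, sub_sub_cancel, Finset.mul_sum, Finset.mul_sum]
    exact Finset.sum_congr rfl fun j _ => by ring

theorem flowCoeff_eq_zero {p : E} {𝒱 : Set (E → E)} {Xs : List (E → E)} (hXs : ∀ X ∈ Xs, X ∈ 𝒱)
    {j : ℕ} {g : E → ℝ}
    (hg : ∀ Ys : List (E → E), (∀ Y ∈ Ys, Y ∈ 𝒱) → Ys.length = j → iterDirDeriv Ys g p = 0) :
    flowCoeff p Xs j g = 0 := by
  induction Xs generalizing j g with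
  | nil =>
    cases j with
    | zero => exact hg [] (by simp) rfl
    | succ j => rfl
  | cons X Xs ih =>
    rw [flowCoeff]
    refine Finset.sum_eq_zero fun k hk => ?_
    rw [ih (fun Z hZ => hXs Z (List.mem_cons_of_mem _ hZ)), mul_zero]
    intro Ys hYs hlen
    have hrep : ∀ k (g : E → ℝ), iterDirDeriv (List.replicate k X ++ Ys) g =
        iterDirDeriv Ys ((dirDeriv X)^[k] g) := by
      intro k
      induction k with
      | zero => intro g; rfl
      | succ k ihk => intro g; exact ihk (dirDeriv X g)
    rw [← hrep k g]
    refine hg _ (fun Y hY => ?_) ?_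
    · rcases List.mem_append.1 hY with h | h
      · exact (List.eq_of_mem_replicate h) ▸ hXs X List.mem_cons_self
      · exact hYs Y h
    · have := Finset.mem_range_succ_iff.1 hk
      simp [hlen, this]

/-- The part of `flowCoeff p (Xs ++ Zs) j g` in which every field of `Xs` occurs. -/
noncomputable def flowCoeffPos (p : E) :
    List (E → E) → List (E → E) → ℕ → (E → ℝ) → ℝ
  | [], Zs, j, g => flowCoeff p Zs j g
  | X :: Xs, Zs, j, g => ∑ k ∈ Finset.range j,
      ((k + 1).factorial : ℝ)⁻¹ * flowCoeffPos p Xs Zs (j - (k + 1)) ((dirDeriv X)^[k + 1] g)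

theorem flowCoeffPos_cons_right (p : E) (Xs : List (E → E)) (Z : E → E) (Zs : List (E → E))
    (j : ℕ) (g : E → ℝ) :
    flowCoeffPos p Xs (Z :: Zs) j g =
      flowCoeffPos p (Xs ++ [Z]) Zs j g + flowCoeffPos p Xs Zs j g := by
  induction Xs generalizing j g with
  | nil => simp [flowCoeffPos, flowCoeff, Finset.sum_range_succ']
  | cons X Xs ih => simp [flowCoeffPos, ih, mul_add, Finset.sum_add_distrib]

theorem flowCoeffPos_eq_zero {p : E} {𝒱 : Set (E → E)} {j : ℕ} {g : E → ℝ}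
    (h : ∀ Xs : List (E → E), (∀ X ∈ Xs, X ∈ 𝒱) → flowCoeff p Xs j g = 0)
    {Xs Zs : List (E → E)} (hXs : ∀ X ∈ Xs, X ∈ 𝒱) (hZs : ∀ Z ∈ Zs, Z ∈ 𝒱) :
    flowCoeffPos p Xs Zs j g = 0 := by
  induction Xs using List.reverseRecOn generalizing Zs with
  | nil => exact h Zs hZs
  | append_singleton Xs X ih =>
    have hXs' : ∀ Y ∈ Xs, Y ∈ 𝒱 := fun Y hY => hXs Y (List.mem_append_left _ hY)
    have hX : X ∈ 𝒱 := hXs X (by simp)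
    have := flowCoeffPos_cons_right p Xs X Zs j g
    rw [ih hXs' hZs, ih hXs' (by simpa [hX] using hZs)] at this
    linarith

theorem flowCoeffPos_of_lt_length (p : E) {Xs : List (E → E)} {j : ℕ} (hj : j < Xs.length)
    (g : E → ℝ) : flowCoeffPos p Xs [] j g = 0 := by
  induction Xs generalizing j g with
  | nil => simp at hj
  | cons X Xs ih =>
    rw [flowCoeffPos]
    refine Finset.sum_eq_zero fun k hk => ?_
    rw [ih, mul_zero]
    have := Finset.mem_range.1 hk
    rw [List.length_cons] at hj
    omega

theorem flowCoeffPos_length (p : E) (Xs : List (E → E)) (g : E → ℝ) :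
    flowCoeffPos p Xs [] Xs.length g = iterDirDeriv Xs g p := by
  induction Xs generalizing g with
  | nil => rfl
  | cons X Xs ih =>
    rw [flowCoeffPos, List.length_cons, Finset.sum_range_succ', Finset.sum_eq_zero]
    · simpa [iterDirDeriv] using ih (dirDeriv X g)
    · intro k hk
      rw [flowCoeffPos_of_lt_length, mul_zero]
      have := Finset.mem_range.1 hk
      omega

theorem eq_zero_of_isBigO_of_odd {h : ℝ → ℝ} {c : ℝ} {m : ℕ} (hm : Odd m)
    (hpos : ∀ᶠ τ in 𝓝 0, 0 ≤ h τ)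
    (hO : (fun τ => h τ - τ ^ m * c) =O[𝓝 0] fun τ => τ ^ (m + 1)) : c = 0 := by
  by_contra hc
  obtain ⟨K, hK⟩ := hO.bound
  have hlim : Tendsto (fun s : ℝ => -(s * c)) (𝓝[>] 0) (𝓝 0) := by
    have : ContinuousAt (fun s : ℝ => -(s * c)) 0 := by fun_prop
    simpa using this.tendsto.mono_left nhdsWithin_le_nhds
  have hKlim : Tendsto (fun s : ℝ => K * s) (𝓝[>] 0) (𝓝 0) := by
    have : ContinuousAt (fun s : ℝ => K * s) 0 := by fun_prop
    simpa using this.tendsto.mono_left nhdsWithin_le_nhds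
  obtain ⟨s, hs, h1, h2, h3⟩ := (eventually_mem_nhdsWithin.and ((hlim.eventually hpos).and
    ((hlim.eventually hK).and (hKlim.eventually_lt_const one_pos)))).exists
  have hs : 0 < s := hs
  have hscalc : (-(s * c)) ^ m * c = -(s ^ m * c ^ (m + 1)) := by
    rw [hm.neg_pow, mul_pow, pow_succ]; ring
  have hnorm : ‖(-(s * c)) ^ (m + 1)‖ = s ^ (m + 1) * c ^ (m + 1) := by
    rw [hm.add_one.neg_pow, mul_pow, Real.norm_of_nonneg]
    exact mul_nonneg (by positivity) (hm.add_one.pow_nonneg c)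
  rw [hscalc, hnorm, Real.norm_eq_abs] at h2
  have hcpos : 0 < s ^ m * c ^ (m + 1) := mul_pos (by positivity) (hm.add_one.pow_pos hc)
  have h4 := (le_abs_self _).trans h2
  have h5 : K * (s ^ (m + 1) * c ^ (m + 1)) = K * s * (s ^ m * c ^ (m + 1)) := by ring
  nlinarith [mul_lt_mul_of_pos_right h3 hcpos]

/-- A smooth function nonnegative on a regular level set `{ρ = 0}` cannot vanish to odd order at a
point with respect to a family of fields tangent to the level set. -/
theorem iterDirDeriv_eq_zero_of_odd [CompleteSpace E] {ρ : E → ℝ}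
    (hρ : ContDiff ℝ (⊤ : ℕ∞) ρ) {p : E} (hp : ρ p = 0) (hreg : fderiv ℝ ρ p ≠ 0)
    {𝒱 : Set (E → E)} (h𝒱 : ∀ X ∈ 𝒱, ContDiff ℝ (⊤ : ℕ∞) X)
    (htan : ∀ X ∈ 𝒱, ∀ x, ρ x = 0 → fderiv ℝ ρ x (X x) = 0)
    {g : E → ℝ} (hg : ContDiff ℝ (⊤ : ℕ∞) g) (hpos : ∀ x, ρ x = 0 → 0 ≤ g x)
    {m : ℕ} (hm : Odd m)
    (hlow : ∀ Ys : List (E → E), (∀ Y ∈ Ys, Y ∈ 𝒱) → Ys.length < m → iterDirDeriv Ys g p = 0)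
    {Xs : List (E → E)} (hXs : ∀ X ∈ Xs, X ∈ 𝒱) (hlen : Xs.length = m) :
    iterDirDeriv Xs g p = 0 := by
  rw [← flowCoeffPos_length, hlen]
  refine flowCoeffPos_eq_zero (𝒱 := 𝒱) (fun Ys hYs => ?_) hXs (by simp)
  obtain ⟨y, -, hyM, hy⟩ := exists_flow_expansion hρ hp hreg Ys
    fun X hX => ⟨h𝒱 X (hYs X hX), htan X (hYs X hX)⟩
  refine eq_zero_of_isBigO_of_odd hm (hyM.mono fun τ hτ => hpos _ hτ) ?_
  refine (hy g hg (m + 1)).congr_left fun τ => ?_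
  rw [Finset.sum_range_succ, Finset.sum_eq_zero, zero_add]
  intro j hj
  rw [flowCoeff_eq_zero hYs, mul_zero]
  exact fun Zs hZs hZlen => hlow Zs hZs (hZlen ▸ Finset.mem_range.1 hj)

end FlowExpansion

section FrameFields

open Complex

variable {n s : ℕ}

theorem clm_apply_eq_sum_wirtinger (D : Cn n →L[ℝ] ℂ) (v : Cn n) :
    D v = ∑ j, v j * ((D (Pi.single j 1) - I * D (Pi.single j I)) / 2) +
      ∑ j, starRingEnd ℂ (v j) * ((D (Pi.single j 1) + I * D (Pi.single j I)) / 2) := by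
  have hv : v = ∑ j, ((v j).re • (Pi.single j 1 : Cn n) + (v j).im • (Pi.single j I : Cn n)) := by
    rw [← Finset.univ_sum_single v]
    refine Finset.sum_congr rfl fun j _ => ?_
    rw [Finset.univ_sum_single, ← Pi.single_smul, ← Pi.single_smul, ← Pi.single_add]
    congr 1
    simp [re_add_im]
  conv_lhs => rw [hv]
  rw [map_sum, ← Finset.sum_add_distrib]
  refine Finset.sum_congr rfl fun j _ => ?_
  rw [map_add, map_smul, map_smul, real_smul, real_smul]
  have h1 := re_add_im (v j)
  have h2 : starRingEnd ℂ (v j) = (v j).re - (v j).im * I := by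
    apply Complex.ext <;> simp
  rw [h2]
  nth_rewrite 3 [← h1]
  linear_combination (((v j).im : ℂ) * D (Pi.single j I)) * I_sq

theorem dirDeriv_eq_sum_wirtinger (X : Cn n → Cn n) (f : Cn n → ℂ) (x : Cn n) :
    dirDeriv X f x = ∑ j, X x j * wz j f x + ∑ j, starRingEnd ℂ (X x j) * wzb j f x :=
  clm_apply_eq_sum_wirtinger _ _

/-- The smooth real vector fields underlying the smooth sections of the bundle with frame `A`. -/
def frameFields (A : Fin s → Fin n → Cn n → ℂ) : Set (Cn n → Cn n) :=
  {X | ∃ c : Fin s → Cn n → ℂ, (∀ i, ContDiff ℝ (⊤ : ℕ∞) (c i)) ∧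
    X = fun x j => secCoeff A c j x}

theorem contDiff_conj {f : Cn n → ℂ} (hf : ContDiff ℝ (⊤ : ℕ∞) f) :
    ContDiff ℝ (⊤ : ℕ∞) fun x => starRingEnd ℂ (f x) :=
  conjCLE.contDiff.comp hf

theorem contDiff_secCoeff {A : Fin s → Fin n → Cn n → ℂ}
    (hA : ∀ i j, ContDiff ℝ (⊤ : ℕ∞) (A i j)) {c : Fin s → Cn n → ℂ}
    (hc : ∀ i, ContDiff ℝ (⊤ : ℕ∞) (c i)) (j : Fin n) :
    ContDiff ℝ (⊤ : ℕ∞) (secCoeff A c j) :=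
  ContDiff.sum fun i _ => (hc i).mul (hA i j)

theorem contDiff_of_mem_frameFields {A : Fin s → Fin n → Cn n → ℂ}
    (hA : ∀ i j, ContDiff ℝ (⊤ : ℕ∞) (A i j)) {X : Cn n → Cn n} (hX : X ∈ frameFields A) :
    ContDiff ℝ (⊤ : ℕ∞) X := by
  obtain ⟨c, hc, rfl⟩ := hX
  exact contDiff_pi.2 fun j => contDiff_secCoeff hA hc j

theorem exists_act_eq_dirDeriv {A : Fin s → Fin n → Cn n → ℂ} {X : Cn n → Cn n}
    (hX : X ∈ frameFields A) : ∃ W, InM1B A W ∧ ∀ f, W.act f = dirDeriv X f := by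
  obtain ⟨c, hc, rfl⟩ := hX
  refine ⟨⟨secCoeff A c, fun j x => starRingEnd ℂ (secCoeff A c j x)⟩,
    ⟨c, fun i x => starRingEnd ℂ (c i x), hc, fun i => contDiff_conj (hc i), fun _ _ => rfl,
      fun j x => by simp [secCoeff]⟩, fun f => funext fun x => ?_⟩
  rw [dirDeriv_eq_sum_wirtinger]
  rfl

theorem exists_act_eq_dirDeriv_add_dirDeriv {A : Fin s → Fin n → Cn n → ℂ} {W : CVF n}
    (hW : InM1B A W) : ∃ U ∈ frameFields A, ∃ V ∈ frameFields A,
      ∀ f, W.act f = fun x => dirDeriv U f x + I * dirDeriv V f x := by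
  obtain ⟨c, d, hc, hd, hhol, hanti⟩ := hW
  refine ⟨_, ⟨fun i x => (c i x + starRingEnd ℂ (d i x)) / 2,
      fun i => ((hc i).add (contDiff_conj (hd i))).div_const 2, rfl⟩,
    _, ⟨fun i x => -I * (c i x - starRingEnd ℂ (d i x)) / 2,
      fun i => (contDiff_const.mul ((hc i).sub (contDiff_conj (hd i)))).div_const 2, rfl⟩,
    fun f => funext fun x => ?_⟩
  rw [dirDeriv_eq_sum_wirtinger, dirDeriv_eq_sum_wirtinger, CVF.act, mul_add, Finset.mul_sum,
    Finset.mul_sum]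
  simp only [← Finset.sum_add_distrib]
  refine Finset.sum_congr rfl fun j _ => ?_
  have h1 : W.hol j x = secCoeff A (fun i x => (c i x + starRingEnd ℂ (d i x)) / 2) j x +
      I * secCoeff A (fun i x => -I * (c i x - starRingEnd ℂ (d i x)) / 2) j x := by
    simp only [hhol, secCoeff]
    rw [Finset.mul_sum, ← Finset.sum_add_distrib]
    refine Finset.sum_congr rfl fun i _ => ?_
    linear_combination (A i j x * (c i x - starRingEnd ℂ (d i x)) / 2) * I_sq
  have h2 : W.anti j x =
      starRingEnd ℂ (secCoeff A (fun i x => (c i x + starRingEnd ℂ (d i x)) / 2) j x) +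
      I * starRingEnd ℂ
        (secCoeff A (fun i x => -I * (c i x - starRingEnd ℂ (d i x)) / 2) j x) := by
    simp only [hanti, secCoeff, map_sum, map_mul, map_div₀, map_sub, map_add, map_neg, conj_I,
      conj_conj, map_ofNat]
    rw [Finset.mul_sum, ← Finset.sum_add_distrib]
    refine Finset.sum_congr rfl fun i _ => ?_
    linear_combination
      (-starRingEnd ℂ (A i j x) * (starRingEnd ℂ (c i x) - d i x) / 2) * I_sq
  rw [h1, h2]
  ring

theorem iterDirDeriv_add_I_mul {Xs : List (Cn n → Cn n)}
    (hXs : ∀ X ∈ Xs, ContDiff ℝ (⊤ : ℕ∞) X) {f g : Cn n → ℂ} (hf : ContDiff ℝ (⊤ : ℕ∞) f)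
    (hg : ContDiff ℝ (⊤ : ℕ∞) g) :
    iterDirDeriv Xs (fun x => f x + I * g x) =
      fun x => iterDirDeriv Xs f x + I * iterDirDeriv Xs g x := by
  induction Xs generalizing f g with
  | nil => rfl
  | cons X Xs ih =>
    have hX := hXs X List.mem_cons_self
    have h : dirDeriv X (fun x => f x + I * g x) =
        fun x => dirDeriv X f x + I * dirDeriv X g x := by
      funext x
      have hfd : DifferentiableAt ℝ f x := hf.differentiable (by simp) x
      have hgd : DifferentiableAt ℝ g x := hg.differentiable (by simp) x
      rw [dirDeriv, fderiv_fun_add hfd (hgd.const_mul I), fderiv_const_mul hgd]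
      rfl
    have := ih (fun Z hZ => hXs Z (List.mem_cons_of_mem _ hZ)) (hf.dirDeriv hX) (hg.dirDeriv hX)
    rwa [← h] at this

theorem foldl_act_eq_zero {A : Fin s → Fin n → Cn n → ℂ}
    (hA : ∀ i j, ContDiff ℝ (⊤ : ℕ∞) (A i j)) {p : Cn n} {f : Cn n → ℂ}
    (hf : ContDiff ℝ (⊤ : ℕ∞) f) {Ws : List (CVF n)} (hWs : ∀ W ∈ Ws, InM1B A W)
    (h : ∀ Xs : List (Cn n → Cn n), (∀ X ∈ Xs, X ∈ frameFields A) → Xs.length = Ws.length →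
      iterDirDeriv Xs f p = 0) :
    Ws.foldl (fun g W => W.act g) f p = 0 := by
  induction Ws generalizing f with
  | nil => exact h [] (by simp) rfl
  | cons W Ws ih =>
    obtain ⟨U, hU, V, hV, hW⟩ := exists_act_eq_dirDeriv_add_dirDeriv (hWs W List.mem_cons_self)
    have hUf := hf.dirDeriv (contDiff_of_mem_frameFields hA hU)
    have hVf := hf.dirDeriv (contDiff_of_mem_frameFields hA hV)
    rw [List.foldl_cons, hW]
    refine ih (hUf.add (contDiff_const.mul hVf))
      (fun Z hZ => hWs Z (List.mem_cons_of_mem _ hZ)) fun Xs hXs hlen => ?_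
    rw [iterDirDeriv_add_I_mul (fun X hX => contDiff_of_mem_frameFields hA (hXs X hX)) hUf hVf]
    have hUz : iterDirDeriv Xs (dirDeriv U f) p = 0 :=
      h (U :: Xs) (by simpa [hU] using hXs) (by simp [hlen])
    have hVz : iterDirDeriv Xs (dirDeriv V f) p = 0 :=
      h (V :: Xs) (by simpa [hV] using hXs) (by simp [hlen])
    simp [hUz, hVz]

theorem exists_foldl_act_eq_iterDirDeriv {A : Fin s → Fin n → Cn n → ℂ}
    {Xs : List (Cn n → Cn n)} (hXs : ∀ X ∈ Xs, X ∈ frameFields A) (f : Cn n → ℂ) :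
    ∃ Ws : List (CVF n), Ws.length = Xs.length ∧ (∀ W ∈ Ws, InM1B A W) ∧
      Ws.foldl (fun g W => W.act g) f = iterDirDeriv Xs f := by
  induction Xs generalizing f with
  | nil => exact ⟨[], rfl, by simp, rfl⟩
  | cons X Xs ih =>
    obtain ⟨W, hW, hWX⟩ := exists_act_eq_dirDeriv (hXs X List.mem_cons_self)
    obtain ⟨Ws, hlen, hWs, hfold⟩ := ih (fun Z hZ => hXs Z (List.mem_cons_of_mem _ hZ))
      (dirDeriv X f)
    refine ⟨W :: Ws, by simp [hlen], by simpa [hW] using hWs, ?_⟩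
    rw [List.foldl_cons, hWX, hfold]
    rfl

theorem fderiv_cx {g : Cn n → ℝ} {x : Cn n} (hg : DifferentiableAt ℝ g x) (v : Cn n) :
    fderiv ℝ (cx g) x v = (fderiv ℝ g x v : ℂ) := by
  have h : HasFDerivAt (cx g) (ofRealCLM ∘L fderiv ℝ g x) x :=
    ofRealCLM.hasFDerivAt.comp x hg.hasFDerivAt
  rw [h.fderiv]
  rfl

theorem contDiff_cx {g : Cn n → ℝ} (hg : ContDiff ℝ (⊤ : ℕ∞) g) :
    ContDiff ℝ (⊤ : ℕ∞) (cx g) :=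
  ofRealCLM.contDiff.comp hg

theorem iterDirDeriv_cx {Xs : List (Cn n → Cn n)} (hXs : ∀ X ∈ Xs, ContDiff ℝ (⊤ : ℕ∞) X)
    {g : Cn n → ℝ} (hg : ContDiff ℝ (⊤ : ℕ∞) g) :
    iterDirDeriv Xs (cx g) = cx (iterDirDeriv Xs g) := by
  induction Xs generalizing g with
  | nil => rfl
  | cons X Xs ih =>
    have h : dirDeriv X (cx g) = cx (dirDeriv X g) := by
      funext x
      exact fderiv_cx (hg.differentiable (by simp) x) _
    have := ih (fun Z hZ => hXs Z (List.mem_cons_of_mem _ hZ))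
      (hg.dirDeriv (hXs X List.mem_cons_self))
    rwa [← h] at this

theorem fderiv_apply_eq_zero_of_isCRField {ρ : Cn n → ℝ} (hρ : ContDiff ℝ (⊤ : ℕ∞) ρ)
    {x ξ : Cn n} (hξ : ∑ j, ξ j * wz j (cx ρ) x = 0) : fderiv ℝ ρ x ξ = 0 := by
  have hd : DifferentiableAt ℝ ρ x := hρ.differentiable (by simp) x
  have hconj : ∀ j, wzb j (cx ρ) x = starRingEnd ℂ (wz j (cx ρ) x) := fun j => by
    simp [wz, wzb, fderiv_cx hd, map_ofNat]
  have h := dirDeriv_eq_sum_wirtinger (fun _ => ξ) (cx ρ) x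
  simp only [hconj, ← map_mul, ← map_sum, hξ, map_zero, add_zero, dirDeriv, fderiv_cx hd] at h
  exact_mod_cast h

theorem contDiff_wzb {f : Cn n → ℂ} (hf : ContDiff ℝ (⊤ : ℕ∞) f) (j : Fin n) :
    ContDiff ℝ (⊤ : ℕ∞) (wzb j f) := by
  have hd : ContDiff ℝ (⊤ : ℕ∞) (fderiv ℝ f) := hf.fderiv_right (by simp)
  exact ((hd.clm_apply contDiff_const).add
    (contDiff_const.mul (hd.clm_apply contDiff_const))).div_const 2

theorem contDiff_wz {f : Cn n → ℂ} (hf : ContDiff ℝ (⊤ : ℕ∞) f) (j : Fin n) :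
    ContDiff ℝ (⊤ : ℕ∞) (wz j f) := by
  have hd : ContDiff ℝ (⊤ : ℕ∞) (fderiv ℝ f) := hf.fderiv_right (by simp)
  exact ((hd.clm_apply contDiff_const).sub
    (contDiff_const.mul (hd.clm_apply contDiff_const))).div_const 2

theorem contDiff_levi {ρ : Cn n → ℝ} (hρ : ContDiff ℝ (⊤ : ℕ∞) ρ) {a : Fin n → Cn n → ℂ}
    (ha : ∀ j, ContDiff ℝ (⊤ : ℕ∞) (a j)) : ContDiff ℝ (⊤ : ℕ∞) (levi ρ a a) :=
  ContDiff.sum fun j _ => ContDiff.sum fun l _ =>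
    ((contDiff_wz (contDiff_wzb (contDiff_cx hρ) l) j).mul (ha j)).mul (contDiff_conj (ha l))

theorem conj_leviCoeff {ρ : Cn n → ℝ} (hρ : ContDiff ℝ (⊤ : ℕ∞) ρ) (j l : Fin n) (x : Cn n) :
    starRingEnd ℂ (leviCoeff ρ j l x) = leviCoeff ρ l j x := by
  have hd : ContDiff ℝ (⊤ : ℕ∞) (fderiv ℝ ρ) := hρ.fderiv_right (by simp)
  have hdx : DifferentiableAt ℝ (fderiv ℝ ρ) x := hd.differentiable (by simp) x
  have hsymm : IsSymmSndFDerivAt ℝ ρ x := by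
    refine hρ.contDiffAt.isSymmSndFDerivAt ?_
    rw [minSmoothness_of_isRCLikeNormedField]
    exact WithTop.coe_le_coe.2 (le_top : (2 : ℕ∞) ≤ ⊤)
  have hwzb : ∀ l, wzb l (cx ρ) = fun y => (cx (fun y => fderiv ℝ ρ y (Pi.single l 1)) y +
      I * cx (fun y => fderiv ℝ ρ y (Pi.single l I)) y) / 2 := fun l => funext fun y => by
    simp only [wzb, fderiv_cx (hρ.differentiable (by simp) y), cx]
  have hdw : ∀ w : Cn n, ContDiff ℝ (⊤ : ℕ∞) fun y => fderiv ℝ ρ y w := fun w =>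
    hd.clm_apply contDiff_const
  have hdc : ∀ w : Cn n, DifferentiableAt ℝ (cx fun y => fderiv ℝ ρ y w) x := fun w =>
    (contDiff_cx (hdw w)).differentiable (by simp) x
  have hfd : ∀ l v, fderiv ℝ (wzb l (cx ρ)) x v =
      ((fderiv ℝ (fderiv ℝ ρ) x v (Pi.single l 1) : ℝ) +
        I * (fderiv ℝ (fderiv ℝ ρ) x v (Pi.single l I) : ℝ)) / 2 := by
    intro l v
    have h2 : ∀ w : Cn n, fderiv ℝ (fun y => fderiv ℝ ρ y w) x v = fderiv ℝ (fderiv ℝ ρ) x v w :=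
      fun w => by
        rw [fderiv_clm_apply hdx (differentiableAt_const w)]
        simp
    have h := (((hdc (Pi.single l 1)).hasFDerivAt.add
      ((hdc (Pi.single l I)).hasFDerivAt.const_mul I)).mul_const ((2 : ℂ)⁻¹)).fderiv
    rw [hwzb l]
    simp only [div_eq_mul_inv]
    erw [h]
    simp [fderiv_cx ((hdw _).differentiable (by simp) x), h2, mul_comm, mul_add]
  simp only [leviCoeff, wz, hfd]
  rw [hsymm.eq (Pi.single l 1) (Pi.single j 1), hsymm.eq (Pi.single l 1) (Pi.single j I),
    hsymm.eq (Pi.single l I) (Pi.single j 1), hsymm.eq (Pi.single l I) (Pi.single j I)]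
  simp only [map_div₀, map_sub, map_add, map_mul, conj_I, conj_ofReal, map_ofNat]
  ring

theorem levi_eq_cx_re {ρ : Cn n → ℝ} (hρ : ContDiff ℝ (⊤ : ℕ∞) ρ) (a : Fin n → Cn n → ℂ) :
    levi ρ a a = cx fun x => (levi ρ a a x).re := by
  funext x
  refine (conj_eq_iff_re.1 ?_).symm
  simp only [levi, map_sum, map_mul, conj_conj, conj_leviCoeff hρ]
  rw [Finset.sum_comm]
  exact Finset.sum_congr rfl fun j _ => Finset.sum_congr rfl fun l _ => by ring

theorem nuB_cx_even_or_eq_top {ρ : Cn n → ℝ} (hρ : ContDiff ℝ (⊤ : ℕ∞) ρ) {p : Cn n}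
    (hp : ρ p = 0) (hreg : fderiv ℝ ρ p ≠ 0) {A : Fin s → Fin n → Cn n → ℂ}
    (hA : ∀ i, IsCRField ρ {x | ρ x = 0} (A i)) {g : Cn n → ℝ} (hg : ContDiff ℝ (⊤ : ℕ∞) g)
    (hpos : ∀ x, ρ x = 0 → 0 ≤ g x) :
    (∃ k : ℕ, nuB A (cx g) p = 2 * (k : ℕ∞)) ∨ nuB A (cx g) p = ⊤ := by
  have hAs : ∀ i j, ContDiff ℝ (⊤ : ℕ∞) (A i j) := fun i => (hA i).1
  rcases Set.eq_empty_or_nonempty {m : ℕ∞ | ∃ Ws : List (CVF n), (Ws.length : ℕ∞) = m ∧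
    (∀ W ∈ Ws, InM1B A W) ∧ (Ws.foldl (fun g W => W.act g) (cx g)) p ≠ 0} with h | h
  · right
    rw [nuB, h, sInf_empty]
  left
  obtain ⟨Ws, hlen, hWs, hne⟩ := csInf_mem h
  have hnu : nuB A (cx g) p = Ws.length := hlen.symm
  rw [hnu]
  rcases Nat.even_or_odd Ws.length with he | ho
  · obtain ⟨k, hk⟩ := he.exists_two_nsmul
    exact ⟨k, by rw [hk]; simp⟩
  refine absurd (foldl_act_eq_zero hAs (contDiff_cx hg) hWs fun Xs hXs hXlen => ?_) hne
  have hsm : ∀ X ∈ frameFields A, ContDiff ℝ (⊤ : ℕ∞) X := fun X hX =>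
    contDiff_of_mem_frameFields hAs hX
  rw [iterDirDeriv_cx (fun X hX => hsm X (hXs X hX)) hg, cx, ofReal_eq_zero]
  refine iterDirDeriv_eq_zero_of_odd hρ hp hreg hsm ?_ hg hpos ho ?_ hXs hXlen
  · rintro X ⟨c, -, rfl⟩ x hx
    refine fderiv_apply_eq_zero_of_isCRField hρ ?_
    have (i : Fin s) := (hA i).2 x hx
    simp only [secCoeff, Finset.sum_mul]
    rw [Finset.sum_comm]
    refine Finset.sum_eq_zero fun i _ => ?_
    simp only [mul_assoc]
    rw [← Finset.mul_sum, this i, mul_zero]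
  · intro Ys hYs hYlen
    by_contra hYne
    obtain ⟨Vs, hVlen, hVs, hfold⟩ := exists_foldl_act_eq_iterDirDeriv hYs (cx g)
    have hle : nuB A (cx g) p ≤ Vs.length := by
      refine sInf_le ⟨Vs, rfl, hVs, ?_⟩
      rw [hfold, iterDirDeriv_cx (fun X hX => hsm X (hYs X hX)) hg]
      simpa [cx] using hYne
    rw [hnu, hVlen, Nat.cast_le] at hle
    omega

end FrameFields

/-- Let `M ⊂ ℂⁿ` (`n ≥ 3`) be a smooth pseudoconvex real hypersurface,
`p ∈ M`, and `L₁, …, L_s` a pointwise independent frame of a rank-`s` subbundle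
`B ⊆ T^{1,0}M`. Then `min_L ν_B(λ(L,L))(p)` (over smooth sections `L` of `B` with
`L(p) ≠ 0`) is even or infinite; consequently `c^{(s)}(B,p) = 2 + min_L ν_B(λ(L,L))(p)`
is even if finite. -/
theorem cTypeB_even {n s : ℕ} (hn : 3 ≤ n) (ρ : Cn n → ℝ) (hρ : ContDiff ℝ (⊤ : ℕ∞) ρ)
    (M : Set (Cn n)) (hM : M = {x | ρ x = 0}) (hreg : ∀ x ∈ M, fderiv ℝ ρ x ≠ 0)
    (hpsc : Pseudoconvex ρ M)
    (A : Fin s → Fin n → Cn n → ℂ) (hA : IsCRFrame ρ M A)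
    (p : Cn n) (hp : p ∈ M) :
    ((∃ k : ℕ, minNuLevi ρ A p = 2 * (k : ℕ∞)) ∨ minNuLevi ρ A p = ⊤) ∧
    (cTypeB ρ A p ≠ ⊤ → ∃ k : ℕ, cTypeB ρ A p = 2 * (k : ℕ∞)) := by
  subst hM
  have hmin : (∃ k : ℕ, minNuLevi ρ A p = 2 * (k : ℕ∞)) ∨ minNuLevi ρ A p = ⊤ := by
    rcases Set.eq_empty_or_nonempty {m : ℕ∞ | ∃ b : Fin s → Cn n → ℂ,
      (∀ i, ContDiff ℝ (⊤ : ℕ∞) (b i)) ∧ (fun j => secCoeff A b j p) ≠ 0 ∧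
      m = nuB A (levi ρ (secCoeff A b) (secCoeff A b)) p} with h | h
    · right
      rw [minNuLevi, h, sInf_empty]
    obtain ⟨b, hb, -, hmb⟩ := csInf_mem h
    have hmb' : minNuLevi ρ A p = nuB A (levi ρ (secCoeff A b) (secCoeff A b)) p := hmb
    have hsec := contDiff_secCoeff (fun i j => (hA.1 i).1 j) hb
    rw [hmb', levi_eq_cx_re hρ]
    refine nuB_cx_even_or_eq_top hρ hp (hreg p hp) hA.1
      (Complex.reCLM.contDiff.comp (contDiff_levi hρ hsec)) fun x hx => ?_
    refine hpsc x hx (fun j => secCoeff A b j x) ?_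
    simp only [secCoeff, Finset.sum_mul]
    rw [Finset.sum_comm]
    refine Finset.sum_eq_zero fun i _ => ?_
    simp only [mul_assoc]
    rw [← Finset.mul_sum, (hA.1 i).2 x hx, mul_zero]
  refine ⟨hmin, fun hfin => ?_⟩
  rcases hmin with ⟨k, hk⟩ | htop
  · exact ⟨k + 1, by rw [cTypeB, hk]; push_cast; ring⟩
  · exact absurd (by rw [cTypeB, htop]; rfl) hfin
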